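/- Let z ∈ ℂ \ [0,∞) and let u : [x₁(z),∞) → ℂ be a bounded continuous solution of the Volterra integral equation u(x) = 1 + ∫ₓ^∞ G(x,y,z) r(y,z) u(y) dy. Then u is differentiable with u'(x) = −p(x)⁻¹ a(x,z)⁻² ∫ₓ^∞ a(y,z)² r(y,z) u(y) dy, the function p·u' is locally absolutely continuous on [x₁(z),∞), and (p(x)u'(x))' − 2ω(x,z)p(x)u'(x) = r(x,z)u(x) for almost every x ≥ x₁(z). -/

import Mathlib

open MeasureTheory Filter Set Complex

noncomputable section

/-- The principal-branch square root `ω(x,z) = ((q x − z)/p x)^{1/2}`. -/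
def omg (p q : ℝ → ℝ) (z : ℂ) (x : ℝ) : ℂ :=
  (((q x : ℂ) - z) / (p x : ℂ)) ^ (1 / 2 : ℂ)

/-- `Ω(x,z) = ∫₀ˣ ω(y,z) dy`. -/
def Omg (p q : ℝ → ℝ) (z : ℂ) (x : ℝ) : ℂ :=
  ∫ y in (0:ℝ)..x, omg p q z y

/-- `a(x,z) = exp(−Ω(x,z))`. -/
def aa (p q : ℝ → ℝ) (z : ℂ) (x : ℝ) : ℂ :=
  Complex.exp (-(Omg p q z x))

/-- Assumption (PQ): `p > 0` on `[0,∞)`, locally absolutely continuous with integrable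
derivative `p'` and limit `p₀ > 0` at `+∞`; `q` integrable on `(0,x₀)`, locally absolutely
continuous on `[x₀,∞)` with integrable derivative `q'` there, and `q → 0` at `+∞`.
Absolute continuity is encoded by the fundamental theorem of calculus representation. -/
structure PQData (p p' q q' : ℝ → ℝ) (p₀ x₀ : ℝ) : Prop where
  p_pos : ∀ x : ℝ, 0 ≤ x → 0 < p x
  hp₀ : 0 < p₀
  hx₀ : 0 ≤ x₀
  p_ac : ∀ x : ℝ, 0 ≤ x → p x = p 0 + ∫ t in (0:ℝ)..x, p' t
  p'_int : IntegrableOn p' (Ioi (0:ℝ))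
  p_lim : Tendsto p atTop (nhds p₀)
  q_int : IntegrableOn q (Ioo (0:ℝ) x₀)
  q_ac : ∀ x : ℝ, x₀ ≤ x → q x = q x₀ + ∫ t in x₀..x, q' t
  q'_int : IntegrableOn q' (Ioi x₀)
  q_lim : Tendsto q atTop (nhds (0:ℝ))

/-- `f` (with derivative `f'`) solves `−(p f')' + q f = z f` on `I`:
`f` is differentiable on `I` with derivative `f'`, and `p·f'` is locally absolutely
continuous on `I` with a.e. derivative `(q − z)·f` (encoded via the FTC representation). -/
def IsSol (p q : ℝ → ℝ) (z : ℂ) (I : Set ℝ) (f f' : ℝ → ℂ) : Prop :=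
  (∀ x ∈ I, HasDerivWithinAt f (f' x) I x) ∧
    ∀ x ∈ I, ∀ y ∈ I,
      (p y : ℂ) * f' y - (p x : ℂ) * f' x = ∫ t in x..y, ((q t : ℂ) - z) * f t

/-- `ε(x) = ∫ₓ^∞ (|p'| + |q'|)`. -/
def eps (p' q' : ℝ → ℝ) (x : ℝ) : ℝ :=
  ∫ y in Ioi x, (|p' y| + |q' y|)

/-- The Volterra kernel `G(x,y,z) = a(y,z)² ∫ₓ^y p(s)⁻¹ a(s,z)⁻² ds`. -/
def Gker (p q : ℝ → ℝ) (z : ℂ) (x y : ℝ) : ℂ :=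
  aa p q z y ^ 2 * ∫ s in x..y, ((p s : ℂ))⁻¹ * (aa p q z s ^ 2)⁻¹

/-- `Φ(x,λ) = ∫₀ˣ √(max((λ − q)/p, 0))`. -/
def Phi (p q : ℝ → ℝ) (lam x : ℝ) : ℝ :=
  ∫ y in (0:ℝ)..x, Real.sqrt (max ((lam - q y) / p y) 0)

/-- `K(λ) = exp(−∫₀^∞ √(max((q − λ)/p, 0)))`. -/
def Kc (p q : ℝ → ℝ) (lam : ℝ) : ℝ :=
  Real.exp (-∫ y in Ioi (0:ℝ), Real.sqrt (max ((q y - lam) / p y) 0))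

/-- `ξ(x) = θ(x)·∫_ϱ^x θ(y)⁻² p(y)⁻¹ dy`. -/
def xiFun (p : ℝ → ℝ) (θ : ℝ → ℂ) (ϱ x : ℝ) : ℂ :=
  θ x * ∫ y in ϱ..x, (θ y ^ 2)⁻¹ * ((p y : ℂ))⁻¹

/-- The derivative of `ξ`: `ξ'(x) = θ'(x)·∫_ϱ^x θ⁻² p⁻¹ + θ(x)⁻¹ p(x)⁻¹`. -/
def xiFun' (p : ℝ → ℝ) (θ θ' : ℝ → ℂ) (ϱ x : ℝ) : ℂ :=
  θ' x * (∫ y in ϱ..x, (θ y ^ 2)⁻¹ * ((p y : ℂ))⁻¹) + (θ x)⁻¹ * ((p x : ℂ))⁻¹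

/-- The derivative of a solution of the Volterra equation:
`u'(x) = −p(x)⁻¹ a(x,z)⁻² ∫ₓ^∞ a(y,z)² r(y) u(y) dy`. -/
def Uder (p q : ℝ → ℝ) (z : ℂ) (r u : ℝ → ℂ) (x : ℝ) : ℂ :=
  -((p x : ℂ))⁻¹ * (aa p q z x ^ 2)⁻¹ * ∫ y in Ioi x, aa p q z y ^ 2 * r y * u y

theorem ac_primitive {f : ℝ → ℂ} {a b c : ℝ} (h : IntervalIntegrable f volume a b)
    (hc : c ∈ uIcc a b) :
    AbsolutelyContinuousOnInterval (fun x ↦ ∫ v in c..x, f v) a b := by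
  have h0 := h.norm.absolutelyContinuousOnInterval_intervalIntegral hc
  rw [absolutelyContinuousOnInterval_iff] at h0 ⊢
  intro ε hε
  obtain ⟨δ, hδ, H⟩ := h0 ε hε
  refine ⟨δ, hδ, fun E hE hs => lt_of_le_of_lt (Finset.sum_le_sum fun i hi => ?_) (H E hE hs)⟩
  have hm := hE.1 i hi
  have hI : ∀ x ∈ uIcc a b, IntervalIntegrable f volume c x := fun x hx =>
    h.mono_set (uIcc_subset_uIcc hc hx)
  rw [dist_eq_norm, dist_eq_norm,
    intervalIntegral.integral_interval_sub_left (hI _ hm.1) (hI _ hm.2),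
    intervalIntegral.integral_interval_sub_left (hI _ hm.1).norm (hI _ hm.2).norm]
  exact intervalIntegral.norm_integral_le_abs_integral_norm

theorem ibp_aux {f f' g g' : ℝ → ℂ} {a b : ℝ} (hab : a ≤ b)
    (hf' : IntervalIntegrable f' volume a b) (hg' : IntervalIntegrable g' volume a b)
    (hf : ∀ x ∈ Icc a b, f x = f a + ∫ t in a..x, f' t)
    (hg : ∀ x ∈ Icc a b, g x = g a + ∫ t in a..x, g' t) :
    f b * g b - f a * g a = ∫ t in a..b, (f' t * g t + f t * g' t) := by
  have hu : uIcc a b = Icc a b := uIcc_of_le hab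
  have hcf := ac_primitive hf' (c := a) (by simp)
  have hcg := ac_primitive hg' (c := a) (by simp)
  have cst : ∀ c : ℂ, AbsolutelyContinuousOnInterval (fun _ => c) a b := fun c =>
    (contDiffOn_const).absolutelyContinuousOnInterval
  set F : ℝ → ℂ := fun x => f a + ∫ t in a..x, f' t with hF
  set G : ℝ → ℂ := fun x => g a + ∫ t in a..x, g' t with hG
  have hFac : AbsolutelyContinuousOnInterval F a b := (cst (f a)).fun_add hcf
  have hGac : AbsolutelyContinuousOnInterval G a b := (cst (g a)).fun_add hcg
  have hint : IntervalIntegrable (fun t => f' t * G t + F t * g' t) volume a b :=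
    (hf'.mul_continuousOn hGac.continuousOn).add (hg'.continuousOn_mul hFac.continuousOn)
  have hIac := ac_primitive hint (c := a) (by simp)
  have hD : AbsolutelyContinuousOnInterval
      (fun x => F x • G x - ∫ t in a..x, (f' t * G t + F t * g' t)) a b :=
    (hFac.fun_smul hGac).fun_sub hIac
  obtain ⟨C, hC⟩ := hD.const_of_ae_hasDerivAt_zero (by
    filter_upwards [hf'.ae_hasDerivAt_integral, hg'.ae_hasDerivAt_integral,
      hint.ae_hasDerivAt_integral] with x h1 h2 h3 hx
    have e1 : HasDerivAt F (f' x) x := (h1 hx a (by simp)).const_add (f a)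
    have e2 : HasDerivAt G (g' x) x := (h2 hx a (by simp)).const_add (g a)
    have := (e1.mul e2).sub (h3 hx a (by simp))
    simp only [smul_eq_mul]
    convert! this using 1
    simp)
  have h1 := hC a (by simp)
  have h2 := hC b (by simp)
  have e : ∫ t in a..b, (f' t * g t + f t * g' t) = ∫ t in a..b, (f' t * G t + F t * g' t) := by
    apply intervalIntegral.integral_congr
    intro t ht
    rw [hu] at ht
    simp only [hf t ht, hg t ht, hF, hG]
  rw [e]
  have hFb : F b = f b := (hf b ⟨hab, le_rfl⟩).symm
  have hGb : G b = g b := (hg b ⟨hab, le_rfl⟩).symm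
  have hFa : F a = f a := (hf a ⟨le_rfl, hab⟩).symm
  have hGa : G a = g a := (hg a ⟨le_rfl, hab⟩).symm
  simp only [hFb, hGb, hFa, hGa, smul_eq_mul, intervalIntegral.integral_same, sub_zero] at h1 h2
  rw [h1, ← h2]; ring

theorem tail_sub {h : ℝ → ℂ} {x₁ : ℝ} (hh : IntegrableOn h (Ioi x₁)) {x y : ℝ}
    (hx : x₁ ≤ x) (hy : x₁ ≤ y) :
    ∫ t in Ioi y, h t = (∫ t in Ioi x, h t) + ∫ t in x..y, (-h t) := by
  have := intervalIntegral.integral_Ioi_sub_Ioi' (hh.mono_set (Ioi_subset_Ioi hx))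
    (hh.mono_set (Ioi_subset_Ioi hy))
  rw [intervalIntegral.integral_neg, ← this]; ring

theorem intervalIntegrable_of_tail {h : ℝ → ℂ} {x₁ : ℝ} (hh : IntegrableOn h (Ioi x₁)) {x y : ℝ}
    (hx : x₁ ≤ x) (hy : x₁ ≤ y) : IntervalIntegrable h volume x y := by
  rw [intervalIntegrable_iff]
  exact hh.mono_set fun t ht => lt_of_le_of_lt (le_min hx hy) ht.1

theorem ftc_Ici {g g' : ℝ → ℂ} {x₁ : ℝ} (hg' : ContinuousOn g' (Ici x₁))
    (hg : ∀ x, x₁ ≤ x → HasDerivWithinAt g (g' x) (Ici x₁) x) {x y : ℝ} (hx : x₁ ≤ x)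
    (hxy : x ≤ y) : g y = g x + ∫ t in x..y, g' t := by
  have := intervalIntegral.integral_eq_sub_of_hasDeriv_right_of_le hxy (f := g) (f' := g')
    (fun t ht => ((hg t (hx.trans ht.1)).continuousWithinAt).mono
      fun s hs => (hx.trans hs.1 : x₁ ≤ s))
    (fun t ht => (hg t (hx.trans ht.1.le)).mono
      fun s hs => (hx.trans (ht.1.le.trans (le_of_lt hs)) : x₁ ≤ s))
    (ContinuousOn.intervalIntegrable (hg'.mono fun s hs => by
      rw [uIcc_of_le hxy] at hs; exact hx.trans hs.1))
  rw [this]; ring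

theorem prod_tail {g g' h : ℝ → ℂ} {x₁ : ℝ} (hg' : ContinuousOn g' (Ici x₁))
    (hg : ∀ x, x₁ ≤ x → HasDerivWithinAt g (g' x) (Ici x₁) x)
    (hh : IntegrableOn h (Ioi x₁)) {x y : ℝ} (hx : x₁ ≤ x) (hy : x₁ ≤ y) :
    g y * (∫ t in Ioi y, h t) - g x * (∫ t in Ioi x, h t)
      = ∫ t in x..y, (g' t * (∫ s in Ioi t, h s) - g t * h t) := by
  wlog hxy : x ≤ y generalizing x y
  · have := this hy hx (le_of_not_ge hxy)
    rw [intervalIntegral.integral_symm, ← this]; ring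
  have := ibp_aux (f := g) (f' := g') (g := fun x => ∫ t in Ioi x, h t) (g' := fun t => - h t) hxy
    (ContinuousOn.intervalIntegrable (hg'.mono fun s hs => by
      rw [uIcc_of_le hxy] at hs; exact hx.trans hs.1))
    (intervalIntegrable_of_tail hh hx hy).neg
    (fun t ht => ftc_Ici hg' hg hx ht.1)
    (fun t ht => tail_sub hh hx (hx.trans ht.1))
  rw [this]
  congr 1; ext t; ring

theorem sqrt_intervalIntegrable {w : ℝ → ℂ} {a b : ℝ} (hw : IntervalIntegrable w volume a b) :
    IntervalIntegrable (fun t => w t ^ (1 / 2 : ℂ)) volume a b := by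
  rw [intervalIntegrable_iff] at hw ⊢
  refine Integrable.mono' (g := fun t => 1 + ‖w t‖) ?_ ?_ ?_
  · exact (integrableOn_const (by simp [uIoc])).add hw.norm
  · exact (hw.aestronglyMeasurable.aemeasurable.pow_const _).aestronglyMeasurable
  · refine Eventually.of_forall fun t => ?_
    have : ‖w t ^ (1 / 2 : ℂ)‖ = ‖w t‖ ^ (1 / 2 : ℝ) := by
      have := Complex.norm_cpow_real (w t) (1/2)
      rw [← this]; norm_num
    rw [this, ← Real.sqrt_eq_rpow]
    have h0 := norm_nonneg (w t)
    rw [Real.sqrt_le_left (by positivity)]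
    nlinarith

theorem re_sqrt_pos {w : ℂ} (hw : w ∈ slitPlane) : 0 < (w ^ (1 / 2 : ℂ)).re := by
  rw [Complex.cpow_def_of_ne_zero (slitPlane_ne_zero hw), Complex.exp_re]
  apply mul_pos (Real.exp_pos _)
  apply Real.cos_pos_of_mem_Ioo
  have h1 := Complex.neg_pi_lt_arg w
  have h2 := (Complex.arg_le_pi w).lt_of_ne (mem_slitPlane_iff_arg.1 hw).1
  have : (log w * (1 / 2)).im = arg w / 2 := by
    have : (1/2 : ℂ) = ((1/2 : ℝ) : ℂ) := by norm_num
    rw [this, Complex.im_mul_ofReal, Complex.log_im]; ring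
  rw [this]
  constructor <;> linarith

theorem sqrt_sq (w : ℂ) : (w ^ (1 / 2 : ℂ)) ^ 2 = w := by
  simp

theorem ac_facts {E : Type*} [NormedAddCommGroup E] [NormedSpace ℝ E] [CompleteSpace E]
    {f f' : ℝ → E} {a : ℝ} (hf' : IntegrableOn f' (Ioi a))
    (hf : ∀ x, a ≤ x → f x = f a + ∫ t in a..x, f' t) :
    ContinuousOn f (Ici a) ∧ ∀ᵐ x ∂(volume : Measure ℝ), a < x → HasDerivAt f (f' x) x := by
  set g := (Ioi a).indicator f' with hg
  have hgi : Integrable g := (integrable_indicator_iff measurableSet_Ioi).2 hf'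
  have key : ∀ x, a ≤ x → f x = f a + ∫ t in a..x, g t := by
    intro x hx
    rw [hf x hx]
    congr 1
    rw [intervalIntegral.integral_of_le hx, intervalIntegral.integral_of_le hx]
    refine setIntegral_congr_fun measurableSet_Ioc fun t ht => ?_
    simp [hg, ht.1]
  constructor
  · refine ContinuousOn.congr (f := fun x => f a + ∫ t in a..x, g t) ?_ key
    exact (continuous_const.add (intervalIntegral.continuous_primitive
      (fun _ _ => hgi.intervalIntegrable) a)).continuousOn
  · filter_upwards [LocallyIntegrable.ae_hasDerivAt_integral hgi.locallyIntegrable] with x hx hax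
    have e : g x = f' x := by simp [hg, hax]
    have := (hx a).const_add (f a)
    rw [e] at this
    refine this.congr_of_eventuallyEq ?_
    filter_upwards [Ioi_mem_nhds hax] with y hy
    exact key y (le_of_lt hy)

theorem lower_bound {f : ℝ → ℝ} {a l : ℝ} (hc : ContinuousOn f (Ici a))
    (hp : ∀ x, a ≤ x → 0 < f x) (hl : Tendsto f atTop (nhds l)) (hl0 : 0 < l) :
    ∃ m, 0 < m ∧ ∀ x, a ≤ x → m ≤ f x := by
  have h1 : ∀ᶠ x in atTop, l / 2 < f x := hl.eventually (lt_mem_nhds (by linarith))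
  obtain ⟨b, hb⟩ := eventually_atTop.1 (h1.and (eventually_ge_atTop a))
  have hab : a ≤ b := (hb b le_rfl).2
  obtain ⟨c, hc1, hc2⟩ := isCompact_Icc.exists_isMinOn (nonempty_Icc.2 hab)
    (hc.mono fun x hx => hx.1)
  refine ⟨min (f c) (l / 2), lt_min (hp c hc1.1) (by linarith), fun x hx => ?_⟩
  rcases le_total x b with h | h
  · exact (min_le_left _ _).trans (hc2 ⟨hx, h⟩)
  · exact (min_le_right _ _).trans (hb x h).1.le

section
variable {p p' q q' : ℝ → ℝ} {p₀ x₀ : ℝ} {z : ℂ} {x₁ : ℝ}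

theorem z_cases (hz : ∀ t : ℝ, 0 ≤ t → (t : ℂ) ≠ z) : z.im ≠ 0 ∨ z.re < 0 := by
  by_contra! h
  exact hz z.re h.2 (Complex.ext (by simp) (by simp [h.1]))

theorem slit_aux (hz : ∀ t : ℝ, 0 ≤ t → (t : ℂ) ≠ z) {a b : ℝ} (ha : |a| ≤ ‖z‖ / 2)
    (hb : 0 < b) : ((a : ℂ) - z) / (b : ℂ) ∈ slitPlane := by
  rw [mem_slitPlane_iff]
  have e : ((a : ℂ) - z) / (b : ℂ) = ((b⁻¹ : ℝ) : ℂ) * (a - z) := by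
    push_cast; rw [div_eq_mul_inv, mul_comm]
  have hb' : 0 < b⁻¹ := inv_pos.2 hb
  rw [e, Complex.re_ofReal_mul, Complex.im_ofReal_mul]
  simp only [sub_re, sub_im, ofReal_re, ofReal_im, zero_sub]
  by_cases h : z.im = 0
  · left
    have h2 := (z_cases hz).resolve_left (by simp [h])
    have : ‖z‖ = -z.re := by
      have : z = (z.re : ℂ) := Complex.ext (by simp) (by simp [h])
      rw [this, Complex.norm_real, Real.norm_of_nonpos h2.le, Complex.ofReal_re]
    have := neg_le_of_abs_le ha
    apply mul_pos hb'
    linarith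
  · right
    simp [h, hb.ne']

theorem omg_re_pos (hPQ : PQData p p' q q' p₀ x₀)
    (hz : ∀ t : ℝ, 0 ≤ t → (t : ℂ) ≠ z) (hx₁ : x₀ ≤ x₁)
    (hx₁q : ∀ x : ℝ, x₁ ≤ x → |q x| ≤ ‖z‖ / 2) {x : ℝ} (hx : x₁ ≤ x) :
    0 < (omg p q z x).re :=
  re_sqrt_pos (slit_aux hz (hx₁q x hx) (hPQ.p_pos x (hPQ.hx₀.trans (hx₁.trans hx))))

theorem p_cont (hPQ : PQData p p' q q' p₀ x₀) : ContinuousOn p (Ici 0) :=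
  (ac_facts hPQ.p'_int hPQ.p_ac).1

theorem q_cont (hPQ : PQData p p' q q' p₀ x₀) : ContinuousOn q (Ici x₀) :=
  (ac_facts hPQ.q'_int hPQ.q_ac).1

theorem omg_cont (hPQ : PQData p p' q q' p₀ x₀)
    (hz : ∀ t : ℝ, 0 ≤ t → (t : ℂ) ≠ z) (hx₁ : x₀ ≤ x₁)
    (hx₁q : ∀ x : ℝ, x₁ ≤ x → |q x| ≤ ‖z‖ / 2) : ContinuousOn (omg p q z) (Ici x₁) := by
  have h0 : (0:ℝ) ≤ x₁ := hPQ.hx₀.trans hx₁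
  have hp : ContinuousOn p (Ici x₁) := (p_cont hPQ).mono (Ici_subset_Ici.2 h0)
  have hq : ContinuousOn q (Ici x₁) := (q_cont hPQ).mono (Ici_subset_Ici.2 hx₁)
  refine ContinuousOn.cpow_const ?_ ?_
  · refine ContinuousOn.div ((continuous_ofReal.comp_continuousOn hq).sub continuousOn_const)
      (continuous_ofReal.comp_continuousOn hp) ?_
    intro x hx
    exact_mod_cast (hPQ.p_pos x (h0.trans hx)).ne'
  · intro x hx
    exact slit_aux hz (hx₁q x hx) (hPQ.p_pos x (h0.trans hx))

theorem omg_lim (hPQ : PQData p p' q q' p₀ x₀)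
    (hz : ∀ t : ℝ, 0 ≤ t → (t : ℂ) ≠ z) :
    ∃ l : ℂ, 0 < l.re ∧ Tendsto (omg p q z) atTop (nhds l) := by
  have hs : (((0:ℝ):ℂ) - z) / (p₀ : ℂ) ∈ slitPlane := slit_aux hz (by simp; positivity) hPQ.hp₀
  refine ⟨_, re_sqrt_pos hs, ?_⟩
  have h1 : Tendsto (fun x => ((q x : ℂ) - z) / (p x : ℂ)) atTop
      (nhds ((((0:ℝ):ℂ) - z) / (p₀ : ℂ))) := by
    refine Tendsto.div (((continuous_ofReal.tendsto _).comp hPQ.q_lim).sub_const z)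
      ((continuous_ofReal.tendsto _).comp hPQ.p_lim) ?_
    exact_mod_cast hPQ.hp₀.ne'
  exact h1.cpow tendsto_const_nhds hs

theorem pomg_lower (hPQ : PQData p p' q q' p₀ x₀)
    (hz : ∀ t : ℝ, 0 ≤ t → (t : ℂ) ≠ z) (hx₁ : x₀ ≤ x₁)
    (hx₁q : ∀ x : ℝ, x₁ ≤ x → |q x| ≤ ‖z‖ / 2) :
    ∃ m, 0 < m ∧ ∀ x, x₁ ≤ x → m ≤ p x * (omg p q z x).re := by
  obtain ⟨l, hl, hlim⟩ := omg_lim hPQ hz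
  have h0 : (0:ℝ) ≤ x₁ := hPQ.hx₀.trans hx₁
  refine lower_bound (l := p₀ * l.re) ?_ ?_ ?_ (mul_pos hPQ.hp₀ hl)
  · exact ((p_cont hPQ).mono (Ici_subset_Ici.2 h0)).mul
      (continuous_re.comp_continuousOn (omg_cont hPQ hz hx₁ hx₁q))
  · exact fun x hx => mul_pos (hPQ.p_pos x (h0.trans hx)) (omg_re_pos hPQ hz hx₁ hx₁q hx)
  · exact hPQ.p_lim.mul ((continuous_re.tendsto _).comp hlim)

theorem p_upper (hPQ : PQData p p' q q' p₀ x₀) :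
    ∃ C, 0 < C ∧ ∀ x, 0 ≤ x → p x ≤ C := by
  obtain ⟨m, hm, h⟩ := lower_bound (f := fun x => (p x)⁻¹) (a := 0) (l := p₀⁻¹)
    ((p_cont hPQ).inv₀ fun x hx => (hPQ.p_pos x hx).ne')
    (fun x hx => inv_pos.2 (hPQ.p_pos x hx)) (hPQ.p_lim.inv₀ hPQ.hp₀.ne') (inv_pos.2 hPQ.hp₀)
  exact ⟨m⁻¹, inv_pos.2 hm, fun x hx => (le_inv_comm₀ hm (hPQ.p_pos x hx)).1 (h x hx)⟩

theorem omg_int (hPQ : PQData p p' q q' p₀ x₀) {x : ℝ} (hx : x₀ ≤ x) :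
    IntervalIntegrable (omg p q z) volume 0 x := by
  refine sqrt_intervalIntegrable ?_
  have hq1 : IntervalIntegrable q volume 0 x₀ :=
    (intervalIntegrable_iff_integrableOn_Ioo_of_le hPQ.hx₀).2 hPQ.q_int
  have hq2 : IntervalIntegrable q volume x₀ x :=
    ContinuousOn.intervalIntegrable ((q_cont hPQ).mono fun s hs => by
      rw [uIcc_of_le hx] at hs; exact hs.1)
  have hq : IntervalIntegrable (fun t => (q t : ℂ) - z) volume 0 x :=
    IntervalIntegrable.sub (intervalIntegrable_iff.2
      (intervalIntegrable_iff.1 (hq1.trans hq2)).ofReal) intervalIntegrable_const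
  simp only [div_eq_mul_inv]
  refine hq.mul_continuousOn ?_
  have h0x := hPQ.hx₀.trans hx
  refine ContinuousOn.inv₀ (continuous_ofReal.comp_continuousOn ((p_cont hPQ).mono fun s hs => ?_))
    fun s hs => ?_
  · rw [uIcc_of_le h0x] at hs; exact hs.1
  · rw [uIcc_of_le h0x] at hs; simpa using (hPQ.p_pos s hs.1).ne'

theorem prim_deriv {f : ℝ → ℂ} {c : ℝ} (hc : ContinuousOn f (Ici x₁)) {x : ℝ}
    (hi : IntervalIntegrable f volume c x) (hx : x₁ ≤ x) :
    HasDerivWithinAt (fun y => ∫ t in c..y, f t) (f x) (Ici x₁) x := by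
  have hm : StronglyMeasurableAtFilter f (nhdsWithin x (Ici x₁)) :=
    hc.stronglyMeasurableAtFilter_nhdsWithin measurableSet_Ici x
  rcases hx.eq_or_lt with h | h
  · subst h
    exact intervalIntegral.integral_hasDerivWithinAt_right hi
      (t := Ioi x₁) (s := Ici x₁)
      (hm.filter_mono (nhdsWithin_mono _ Ioi_subset_Ici_self))
      ((hc x₁ self_mem_Ici).mono Ioi_subset_Ici_self)
  · have hn : Ici x₁ ∈ nhds x := Ici_mem_nhds h
    rw [nhdsWithin_eq_nhds.2 hn] at hm
    exact (intervalIntegral.integral_hasDerivAt_right hi hm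
      (hc.continuousAt hn)).hasDerivWithinAt

theorem Omg_deriv (hPQ : PQData p p' q q' p₀ x₀)
    (hz : ∀ t : ℝ, 0 ≤ t → (t : ℂ) ≠ z) (hx₁ : x₀ ≤ x₁)
    (hx₁q : ∀ x : ℝ, x₁ ≤ x → |q x| ≤ ‖z‖ / 2) {x : ℝ} (hx : x₁ ≤ x) :
    HasDerivWithinAt (Omg p q z) (omg p q z x) (Ici x₁) x :=
  prim_deriv (omg_cont hPQ hz hx₁ hx₁q) (omg_int hPQ (hx₁.trans hx)) hx

theorem aa_ne (x : ℝ) : aa p q z x ≠ 0 := Complex.exp_ne_zero _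

theorem ainv_deriv (hPQ : PQData p p' q q' p₀ x₀)
    (hz : ∀ t : ℝ, 0 ≤ t → (t : ℂ) ≠ z) (hx₁ : x₀ ≤ x₁)
    (hx₁q : ∀ x : ℝ, x₁ ≤ x → |q x| ≤ ‖z‖ / 2) {x : ℝ} (hx : x₁ ≤ x) :
    HasDerivWithinAt (fun t => (aa p q z t ^ 2)⁻¹) (2 * omg p q z x * (aa p q z x ^ 2)⁻¹)
      (Ici x₁) x := by
  have e : ∀ t, (aa p q z t ^ 2)⁻¹ = Complex.exp (2 * Omg p q z t) := by
    intro t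
    rw [aa, ← Complex.exp_nat_mul, ← Complex.exp_neg]; congr 1; push_cast; ring
  simp only [e]
  have := ((Omg_deriv hPQ hz hx₁ hx₁q hx).const_mul 2).cexp
  convert! this using 1
  ring

theorem norm_ainv (x : ℝ) : ‖(aa p q z x ^ 2)⁻¹‖ = Real.exp (2 * (Omg p q z x).re) := by
  have e : (aa p q z x ^ 2)⁻¹ = Complex.exp (2 * Omg p q z x) := by
    rw [aa, ← Complex.exp_nat_mul, ← Complex.exp_neg]; congr 1; push_cast; ring
  rw [e, Complex.norm_exp]; simp

theorem nainv_deriv (hPQ : PQData p p' q q' p₀ x₀)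
    (hz : ∀ t : ℝ, 0 ≤ t → (t : ℂ) ≠ z) (hx₁ : x₀ ≤ x₁)
    (hx₁q : ∀ x : ℝ, x₁ ≤ x → |q x| ≤ ‖z‖ / 2) {x : ℝ} (hx : x₁ ≤ x) :
    HasDerivWithinAt (fun t => ‖(aa p q z t ^ 2)⁻¹‖)
      (‖(aa p q z x ^ 2)⁻¹‖ * (2 * (omg p q z x).re)) (Ici x₁) x := by
  simp only [norm_ainv]
  have h1 : HasDerivWithinAt (fun t => (Omg p q z t).re) (omg p q z x).re (Ici x₁) x :=
    Complex.reCLM.hasFDerivAt.comp_hasDerivWithinAt x (Omg_deriv hPQ hz hx₁ hx₁q hx)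
  exact (h1.const_mul 2).exp

theorem r_int (hPQ : PQData p p' q q' p₀ x₀)
    (hz : ∀ t : ℝ, 0 ≤ t → (t : ℂ) ≠ z) (hx₁ : x₀ ≤ x₁)
    (hx₁q : ∀ x : ℝ, x₁ ≤ x → |q x| ≤ ‖z‖ / 2) {r : ℝ → ℂ}
    (hr : ∀ᵐ x ∂(volume : Measure ℝ), x₁ ≤ x →
      HasDerivAt (fun t => (p t : ℂ) * omg p q z t) (r x) x) :
    IntegrableOn r (Ioi x₁) := by
  have h0 : (0:ℝ) ≤ x₁ := hPQ.hx₀.trans hx₁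
  obtain ⟨m, hm, hmb⟩ := pomg_lower hPQ hz hx₁ hx₁q
  obtain ⟨C, hC, hCb⟩ := p_upper hPQ
  have hp : ContinuousOn p (Ioi x₁) := (p_cont hPQ).mono fun x hx => h0.trans (le_of_lt hx)
  have hq : ContinuousOn q (Ioi x₁) := (q_cont hPQ).mono fun x hx => hx₁.trans (le_of_lt hx)
  have hw : ContinuousOn (omg p q z) (Ioi x₁) :=
    (omg_cont hPQ hz hx₁ hx₁q).mono Ioi_subset_Ici_self
  have hp' : IntegrableOn p' (Ioi x₁) := hPQ.p'_int.mono_set (Ioi_subset_Ioi h0)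
  have hq' : IntegrableOn q' (Ioi x₁) := hPQ.q'_int.mono_set (Ioi_subset_Ioi hx₁)
  have hne : ∀ x, x₁ ≤ x → m ≤ ‖(p x : ℂ) * omg p q z x‖ := by
    intro x hx
    refine (hmb x hx).trans ?_
    have : p x * (omg p q z x).re = ((p x : ℂ) * omg p q z x).re := by simp
    rw [this]; exact Complex.re_le_norm _
  have heq : ∀ᵐ x ∂(volume : Measure ℝ), x₁ < x →
      r x = ((p' x : ℂ) * (q x - z) + p x * q' x) / (2 * (p x * omg p q z x)) := by
    filter_upwards [hr, (ac_facts hPQ.p'_int hPQ.p_ac).2, (ac_facts hPQ.q'_int hPQ.q_ac).2]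
      with x h1 h2 h3 hx
    have d1 := (h1 hx.le).mul (h1 hx.le)
    have d2 := (h2 (h0.trans_lt hx)).ofReal_comp.mul
      ((h3 (hx₁.trans_lt hx)).ofReal_comp.sub_const z)
    have hev : ((fun t => (p t : ℂ) * omg p q z t) * fun t => (p t : ℂ) * omg p q z t)
        =ᶠ[nhds x] ((fun t => (p t : ℂ)) * fun t => ((q t : ℂ) - z)) := by
      filter_upwards [Ioi_mem_nhds hx] with t ht
      have hpt : (p t : ℂ) ≠ 0 := by
        exact_mod_cast (hPQ.p_pos t (h0.trans (le_of_lt ht))).ne'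
      have hs : omg p q z t ^ 2 = ((q t : ℂ) - z) / p t := sqrt_sq _
      simp only [Pi.mul_apply]
      calc _ = (p t : ℂ) ^ 2 * omg p q z t ^ 2 := by ring
        _ = _ := by rw [hs]; field_simp
    have d3 := d1.unique (d2.congr_of_eventuallyEq hev)
    have hn : (p x : ℂ) * omg p q z x ≠ 0 := by
      rw [← norm_pos_iff]; exact hm.trans_le (hne x hx.le)
    rw [eq_div_iff (by simpa using hn)]
    linear_combination d3
  have hmeas : AEStronglyMeasurable
      (fun x => ((p' x : ℂ) * (q x - z) + p x * q' x) / (2 * (p x * omg p q z x)))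
      (volume.restrict (Ioi x₁)) := by
    have cp := (hp.aemeasurable measurableSet_Ioi (μ := volume)).complex_ofReal
    have cq := (hq.aemeasurable measurableSet_Ioi (μ := volume)).complex_ofReal
    have cw := (hw.aemeasurable measurableSet_Ioi (μ := volume))
    have cp' := hp'.aestronglyMeasurable.aemeasurable.complex_ofReal
    have cq' := hq'.aestronglyMeasurable.aemeasurable.complex_ofReal
    exact (((cp'.mul (cq.sub aemeasurable_const)).add (cp.mul cq')).div
      ((cp.mul cw).const_mul 2)).aestronglyMeasurable
  have hF : IntegrableOn
      (fun x => ((p' x : ℂ) * (q x - z) + p x * q' x) / (2 * (p x * omg p q z x))) (Ioi x₁) := by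
    refine Integrable.mono' (g := fun x => (|p' x| * (‖z‖ / 2 + ‖z‖) + C * |q' x|) / (2 * m))
      (((hp'.abs.mul_const _).add (hq'.abs.const_mul C)).div_const _) hmeas ?_
    filter_upwards [ae_restrict_mem measurableSet_Ioi] with x hx
    have hx' : x₁ ≤ x := le_of_lt hx
    rw [norm_div]
    refine div_le_div₀ (by positivity) ?_ (by positivity) ?_
    · refine (norm_add_le _ _).trans (add_le_add ?_ ?_)
      · rw [norm_mul, Complex.norm_real, Real.norm_eq_abs]
        refine mul_le_mul_of_nonneg_left ((norm_sub_le _ _).trans ?_) (abs_nonneg _)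
        rw [Complex.norm_real, Real.norm_eq_abs]
        linarith [hx₁q x hx']
      · rw [norm_mul, Complex.norm_real, Complex.norm_real, Real.norm_eq_abs, Real.norm_eq_abs,
          abs_of_pos (hPQ.p_pos x (h0.trans hx'))]
        exact mul_le_mul_of_nonneg_right (hCb x (h0.trans hx')) (abs_nonneg _)
    · rw [norm_mul]; simpa using hne x hx'
  refine hF.congr ?_
  filter_upwards [ae_restrict_mem measurableSet_Ioi, ae_restrict_of_ae heq] with x hx h
  exact (h hx).symm

end

/-- a bounded continuous solution `u` of the Volterra equation is
differentiable with derivative `Uder`, `p·u'` is locally absolutely continuous on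
`[x₁,∞)`, and `(pu')' − 2ωpu' = r·u` a.e. on `[x₁,∞)`. -/
theorem statement7 (p p' q q' : ℝ → ℝ) (p₀ x₀ : ℝ)
    (hPQ : PQData p p' q q' p₀ x₀)
    (z : ℂ) (hz : ∀ t : ℝ, 0 ≤ t → (t : ℂ) ≠ z)
    (x₁ : ℝ) (hx₁ : x₀ ≤ x₁) (hx₁q : ∀ x : ℝ, x₁ ≤ x → |q x| ≤ ‖z‖ / 2)
    (r : ℝ → ℂ)
    (hr : ∀ᵐ x ∂(volume : Measure ℝ), x₁ ≤ x →
      HasDerivAt (fun t => (p t : ℂ) * omg p q z t) (r x) x)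
    (u : ℝ → ℂ)
    (hcont : ContinuousOn u (Ici x₁))
    (hbdd : ∃ M : ℝ, ∀ x : ℝ, x₁ ≤ x → ‖u x‖ ≤ M)
    (hvolt : ∀ x : ℝ, x₁ ≤ x →
      u x = 1 + ∫ y in Ioi x, Gker p q z x y * r y * u y) :
    (∀ x : ℝ, x₁ ≤ x → HasDerivWithinAt u (Uder p q z r u x) (Ici x₁) x) ∧
      ∃ v : ℝ → ℂ,
        (∀ x : ℝ, x₁ ≤ x → ∀ y : ℝ, x₁ ≤ y →
          (p y : ℂ) * Uder p q z r u y - (p x : ℂ) * Uder p q z r u x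
            = ∫ t in x..y, v t) ∧
        ∀ᵐ x ∂(volume : Measure ℝ), x₁ ≤ x →
          v x - 2 * omg p q z x * (p x : ℂ) * Uder p q z r u x = r x * u x := by
  have h0 : (0:ℝ) ≤ x₁ := hPQ.hx₀.trans hx₁
  have hri := r_int hPQ hz hx₁ hx₁q hr
  have hw := omg_cont hPQ hz hx₁ hx₁q
  obtain ⟨m, hm, hmb⟩ := pomg_lower hPQ hz hx₁ hx₁q
  obtain ⟨M, hM⟩ := hbdd
  have hpne : ∀ x, x₁ ≤ x → (p x : ℂ) ≠ 0 := fun x hx => by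
    exact_mod_cast (hPQ.p_pos x (h0.trans hx)).ne'
  have hbd := fun x hx => ainv_deriv (x := x) hPQ hz hx₁ hx₁q hx
  have hnbd := fun x hx => nainv_deriv (x := x) hPQ hz hx₁ hx₁q hx
  have hbc : ContinuousOn (fun t => (aa p q z t ^ 2)⁻¹) (Ici x₁) := fun x hx =>
    (hbd x hx).continuousWithinAt
  have hnbc : ContinuousOn (fun t => ‖(aa p q z t ^ 2)⁻¹‖) (Ici x₁) := hbc.norm
  have hac : ContinuousOn (fun t => aa p q z t ^ 2) (Ici x₁) := by
    have := hbc.inv₀ (fun x _ => inv_ne_zero (pow_ne_zero 2 (aa_ne x)))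
    refine this.congr fun x _ => ?_
    simp
  set P' : ℝ → ℂ := fun s => ((p s : ℂ))⁻¹ * (aa p q z s ^ 2)⁻¹ with hP'
  have hP'c : ContinuousOn P' (Ici x₁) :=
    ((continuous_ofReal.comp_continuousOn ((p_cont hPQ).mono (Ici_subset_Ici.2 h0))).inv₀
      hpne).mul hbc
  have hP'i : ∀ x y, x₁ ≤ x → x₁ ≤ y → IntervalIntegrable P' volume x y := fun x y hx hy =>
    ContinuousOn.intervalIntegrable (hP'c.mono fun s hs => (le_min hx hy).trans hs.1)
  set P : ℝ → ℂ := fun y => ∫ s in x₁..y, P' s with hP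
  have hPd : ∀ x, x₁ ≤ x → HasDerivWithinAt P (P' x) (Ici x₁) x := fun x hx =>
    prim_deriv hP'c (hP'i _ _ le_rfl hx) hx
  have hPc : ContinuousOn P (Ici x₁) := fun x hx => (hPd x hx).continuousWithinAt
  have hPb : ∀ y, x₁ ≤ y → ‖P y‖ ≤ (2 * m)⁻¹ * ‖(aa p q z y ^ 2)⁻¹‖ := by
    intro y hy
    have sub : Icc x₁ y ⊆ Ici x₁ := fun s hs => hs.1
    refine image_norm_le_of_norm_deriv_right_le_deriv_boundary' (a := x₁) (b := y)
      (f := P) (f' := P') (B := fun y => (2 * m)⁻¹ * ‖(aa p q z y ^ 2)⁻¹‖)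
      (B' := fun x => (2 * m)⁻¹ * (‖(aa p q z x ^ 2)⁻¹‖ * (2 * (omg p q z x).re)))
      (hPc.mono sub) (fun x hx => (hPd x hx.1).mono (Ici_subset_Ici.2 hx.1)) ?_
      ((continuousOn_const.mul hnbc).mono sub)
      (fun x hx => ((hnbd x hx.1).const_mul _).mono (Ici_subset_Ici.2 hx.1)) ?_ ⟨hy, le_rfl⟩
    · simp only [hP, intervalIntegral.integral_same, norm_zero]; positivity
    · intro x hx
      have hpx := hPQ.p_pos x (h0.trans hx.1)
      simp only [hP']
      rw [norm_mul, norm_inv, Complex.norm_real, Real.norm_of_nonneg hpx.le]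
      have h1 : (p x)⁻¹ ≤ (2 * m)⁻¹ * (2 * (omg p q z x).re) := by
        rw [inv_mul_eq_div, le_div_iff₀ (by positivity), inv_mul_le_iff₀ hpx]
        linarith [hmb x hx.1]
      calc _ ≤ ((2 * m)⁻¹ * (2 * (omg p q z x).re)) * ‖(aa p q z x ^ 2)⁻¹‖ :=
            mul_le_mul_of_nonneg_right h1 (norm_nonneg _)
        _ = _ := by ring
  have hab : ∀ y, x₁ ≤ y → ‖(aa p q z x₁ ^ 2)⁻¹‖ ≤ ‖(aa p q z y ^ 2)⁻¹‖ := by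
    intro y hy
    have sub : Icc x₁ y ⊆ Ici x₁ := fun s hs => hs.1
    refine image_norm_le_of_norm_deriv_right_le_deriv_boundary' (a := x₁) (b := y)
      (f := fun _ => (aa p q z x₁ ^ 2)⁻¹) (f' := fun _ => 0)
      (B := fun y => ‖(aa p q z y ^ 2)⁻¹‖)
      (B' := fun x => (‖(aa p q z x ^ 2)⁻¹‖ * (2 * (omg p q z x).re)))
      continuousOn_const (fun x hx => hasDerivWithinAt_const _ _ _) le_rfl
      (hnbc.mono sub)
      (fun x hx => (hnbd x hx.1).mono (Ici_subset_Ici.2 hx.1)) ?_ ⟨hy, le_rfl⟩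
    intro x hx
    have := omg_re_pos hPQ hz hx₁ hx₁q hx.1
    simp only [norm_zero]
    positivity
  have hM0 : 0 ≤ M := (norm_nonneg _).trans (hM x₁ le_rfl)
  have hmul : ∀ (g : ℝ → ℂ) (K : ℝ), ContinuousOn g (Ici x₁) → (∀ x, x₁ ≤ x → ‖g x‖ ≤ K) →
      IntegrableOn (fun x => g x * r x) (Ioi x₁) := by
    intro g K hg hK
    refine Integrable.bdd_mul (c := K) hri
      ((hg.mono Ioi_subset_Ici_self).aestronglyMeasurable measurableSet_Ioi) ?_
    filter_upwards [ae_restrict_mem measurableSet_Ioi] with x hx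
    exact hK x (le_of_lt hx)
  set h : ℝ → ℂ := fun y => aa p q z y ^ 2 * r y * u y with hh
  have hhi : IntegrableOn h (Ioi x₁) := by
    have := hmul (fun y => aa p q z y ^ 2 * u y) (‖(aa p q z x₁ ^ 2)⁻¹‖⁻¹ * M) (hac.mul hcont) (by
      intro x hx
      rw [norm_mul]
      refine mul_le_mul ?_ (hM x hx) (norm_nonneg _) (by positivity)
      rw [le_inv_comm₀ (norm_pos_iff.2 (pow_ne_zero 2 (aa_ne x)))
        (norm_pos_iff.2 (inv_ne_zero (pow_ne_zero 2 (aa_ne x₁)))), ← norm_inv]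
      exact hab x hx)
    refine this.congr_fun (fun y _ => ?_) measurableSet_Ioi
    simp only [hh]; ring
  have hhP : IntegrableOn (fun y => h y * P y) (Ioi x₁) := by
    have := hmul (fun y => (aa p q z y ^ 2 * P y) * u y) ((2 * m)⁻¹ * M)
      ((hac.mul hPc).mul hcont) (by
      intro x hx
      rw [norm_mul]
      refine mul_le_mul ?_ (hM x hx) (norm_nonneg _) (by positivity)
      rw [norm_mul]
      refine (mul_le_mul_of_nonneg_left (hPb x hx) (norm_nonneg _)).trans_eq ?_
      have : ‖aa p q z x ^ 2‖ ≠ 0 := norm_ne_zero_iff.2 (pow_ne_zero 2 (aa_ne x))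
      rw [norm_inv]; field_simp)
    refine this.congr_fun (fun y _ => ?_) measurableSet_Ioi
    simp only [hh]; ring
  set H : ℝ → ℂ := fun x => ∫ y in Ioi x, h y with hH
  have hHc : ContinuousOn H (Ici x₁) :=
    (ac_facts (f := H) (f' := fun t => -h t) hhi.neg
      (fun x hx => tail_sub hhi le_rfl hx)).1
  have hu : ∀ x, x₁ ≤ x → u x = 1 + (∫ y in Ioi x, h y * P y) - P x * H x := by
    intro x hx
    have e : ∫ y in Ioi x, Gker p q z x y * r y * u y
        = ∫ y in Ioi x, (h y * P y - P x * h y) := by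
      refine setIntegral_congr_fun measurableSet_Ioi fun y hy => ?_
      have hy' : x₁ ≤ y := hx.trans (le_of_lt hy)
      have e2 : ∫ s in x..y, P' s = P y - P x :=
        (intervalIntegral.integral_interval_sub_left (hP'i _ _ le_rfl hy')
          (hP'i _ _ le_rfl hx)).symm
      have e3 : Gker p q z x y = aa p q z y ^ 2 * (P y - P x) := by rw [← e2]; rfl
      simp only [e3, hh]; ring
    rw [hvolt x hx, e, integral_sub (hhP.mono_set (Ioi_subset_Ioi hx))
      ((hhi.mono_set (Ioi_subset_Ioi hx)).const_mul _), integral_const_mul]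
    ring
  have hiP' : ∀ x y, x₁ ≤ x → x₁ ≤ y →
      IntervalIntegrable (fun t => P' t * H t) volume x y := fun x y hx hy =>
    ContinuousOn.intervalIntegrable ((hP'c.mul hHc).mono fun s hs => (le_min hx hy).trans hs.1)
  have hu2 : ∀ x, x₁ ≤ x → u x = u x₁ + ∫ t in x₁..x, -(P' t * H t) := by
    intro x hx
    have k1 := prod_tail hP'c hPd hhi le_rfl hx
    have k2 := tail_sub hhP le_rfl hx
    rw [intervalIntegral.integral_sub (hiP' _ _ le_rfl hx)
      ((intervalIntegrable_of_tail hhi le_rfl hx).continuousOn_mul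
        (hPc.mono fun s hs => (le_min le_rfl hx).trans hs.1))] at k1
    have k3 : ∫ t in x₁..x, P t * h t = ∫ t in x₁..x, h t * P t := by
      congr 1; ext t; ring
    rw [hu x hx, hu x₁ le_rfl, k2, intervalIntegral.integral_neg, intervalIntegral.integral_neg,
      ← k3]
    simp only [hH]
    linear_combination -k1
  have hU : ∀ x, x₁ ≤ x → (p x : ℂ) * Uder p q z r u x = -((aa p q z x ^ 2)⁻¹ * H x) := by
    intro x hx
    have := hpne x hx
    simp only [Uder, hH, hh]
    rw [neg_mul, neg_mul, mul_neg, ← mul_assoc, ← mul_assoc, mul_inv_cancel₀ this, one_mul]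
  refine ⟨fun x hx => ?_, fun t => -(2 * omg p q z t * (aa p q z t ^ 2)⁻¹ * H t
    - (aa p q z t ^ 2)⁻¹ * h t), ?_, ?_⟩
  · have hd := (prim_deriv (c := x₁) (hP'c.mul hHc).neg (hiP' x₁ x le_rfl hx).neg hx).const_add
      (u x₁)
    have e : Uder p q z r u x = -(P' x * H x) := by
      simp only [Uder, hP', hH, hh]; ring
    rw [e]
    exact hd.congr (fun y hy => hu2 y hy) (hu2 x hx)
  · intro x hx y hy
    have k := prod_tail (g' := fun t => 2 * omg p q z t * (aa p q z t ^ 2)⁻¹)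
      ((continuousOn_const.mul hw).mul hbc) hbd hhi hx hy
    rw [hU x hx, hU y hy, intervalIntegral.integral_neg, ← k]
    ring
  · refine Eventually.of_forall fun x hx => ?_
    have ha := pow_ne_zero 2 (aa_ne (p := p) (q := q) (z := z) x)
    rw [mul_assoc, hU x hx]
    have e : (aa p q z x ^ 2)⁻¹ * h x = r x * u x := by
      simp only [hh]
      rw [mul_assoc, ← mul_assoc, inv_mul_cancel₀ ha, one_mul]
    beta_reduce
    rw [e]
    ring

end
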